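/- Let $1 < p < n$ and $0 < \gamma < \infty$, and set $r = n(p-1+\gamma)/(n-p)$, $\rho = p-1+\gamma$. Then for any nonnegative Radon measure $\mu$ on $\mathbb{R}^n$, $\|\mathbf{W}_{1,p}\mu\|_{L^{r,\rho}(\mathbb{R}^n)} \leq C\left(\int_{\mathbb{R}^n} (\mathbf{W}_{1,p}\mu)^\gamma\, d\mu\right)^{\frac{1}{p-1+\gamma}}$, where $C = C(n,p,\gamma)$ and $L^{r,\rho}$ denotes the Lorentz space with respect to Lebesgue measure. -/

import Mathlib

open MeasureTheory Metric ENNReal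

/-- The Wolff potential `W_{1,p}σ(x) = ∫₀^∞ (σ(B(x,r))/r^{n-p})^{1/(p-1)} dr/r`. -/
noncomputable def wolff (n : ℕ) (p : ℝ) (σ : Measure (EuclideanSpace ℝ (Fin n)))
    (x : EuclideanSpace ℝ (Fin n)) : ℝ≥0∞ :=
  ∫⁻ r in Set.Ioi (0 : ℝ),
    (σ (ball x r) / ENNReal.ofReal (r ^ ((n : ℝ) - p))) ^ (1 / (p - 1)) / ENNReal.ofReal r

/-- The decreasing rearrangement of `f` with respect to Lebesgue measure. -/
noncomputable def rearrangement {n : ℕ} (f : EuclideanSpace ℝ (Fin n) → ℝ≥0∞) (t : ℝ) : ℝ≥0∞ :=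
  sInf {a : ℝ≥0∞ | volume {x | a < f x} ≤ ENNReal.ofReal t}

/-- The Lorentz `L^{r,ρ}` quasinorm (with respect to Lebesgue measure),
`‖f‖_{L^{r,ρ}} = (∫₀^∞ (t^{1/r} f^*(t))^ρ dt/t)^{1/ρ}`. -/
noncomputable def lorentzNorm {n : ℕ} (r ρ : ℝ) (f : EuclideanSpace ℝ (Fin n) → ℝ≥0∞) : ℝ≥0∞ :=
  (∫⁻ t in Set.Ioi (0 : ℝ),
    (ENNReal.ofReal (t ^ (1 / r)) * rearrangement f t) ^ ρ / ENNReal.ofReal t) ^ (1 / ρ)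


open Filter Topology

/-- ENNReal-valued layer cake formula. -/
lemma layercake_ennreal {α : Type*} [MeasurableSpace α] (ν : Measure α) {f : α → ℝ≥0∞}
    (hf : Measurable f) {q : ℝ} (hq : 0 < q) :
    ∫⁻ x, f x ^ q ∂ν = ENNReal.ofReal q *
      ∫⁻ t in Set.Ioi (0:ℝ), ν {a | ENNReal.ofReal t < f a} * ENNReal.ofReal (t ^ (q - 1)) := by
  by_cases h : ν {x | f x = ⊤} = 0
  · have hfin : ∀ᵐ x ∂ν, f x ≠ ⊤ := by
      rw [ae_iff]; simpa using h
    have h1 := lintegral_rpow_eq_lintegral_meas_lt_mul ν (f := fun x => (f x).toReal)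
      (Eventually.of_forall fun x => ENNReal.toReal_nonneg) hf.ennreal_toReal.aemeasurable hq
    have h2 : ∫⁻ x, f x ^ q ∂ν = ∫⁻ x, ENNReal.ofReal ((f x).toReal ^ q) ∂ν := by
      apply lintegral_congr_ae
      filter_upwards [hfin] with x hx
      rw [← ENNReal.ofReal_rpow_of_nonneg ENNReal.toReal_nonneg hq.le, ENNReal.ofReal_toReal hx]
    rw [h2, h1]
    congr 1
    apply setLIntegral_congr_fun measurableSet_Ioi
    intro t ht
    dsimp only
    congr 1
    apply measure_congr
    filter_upwards [hfin] with x hx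
    apply propext
    change t < (f x).toReal ↔ ENNReal.ofReal t < f x
    rw [ENNReal.ofReal_lt_iff_lt_toReal (le_of_lt ht) hx]
  · have hL : ∫⁻ x, f x ^ q ∂ν = ⊤ := by
      by_contra hne
      have := ae_lt_top (hf.pow_const q) hne
      apply h
      rw [ae_iff] at this
      convert this using 3
      ext x
      simp [hq, hq.not_gt]
    have hR : ∫⁻ t in Set.Ioi (0:ℝ), ENNReal.ofReal (t ^ (q - 1)) = ⊤ := by
      by_contra hne
      apply not_integrableOn_Ioi_rpow (q - 1)
      refine ⟨by fun_prop, ?_⟩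
      rw [hasFiniteIntegral_iff_ofReal]
      · exact lt_top_iff_ne_top.2 hne
      · filter_upwards [ae_restrict_mem measurableSet_Ioi] with t ht
        exact Real.rpow_nonneg (le_of_lt ht) _
    rw [hL]
    symm
    have : ∫⁻ t in Set.Ioi (0:ℝ), ν {a | ENNReal.ofReal t < f a} * ENNReal.ofReal (t ^ (q - 1)) = ⊤ := by
      rw [eq_top_iff]
      calc ⊤ = ν {x | f x = ⊤} * ∫⁻ t in Set.Ioi (0:ℝ), ENNReal.ofReal (t ^ (q - 1)) := by
            rw [hR, ENNReal.mul_top h]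
        _ = ∫⁻ t in Set.Ioi (0:ℝ), ν {x | f x = ⊤} * ENNReal.ofReal (t ^ (q - 1)) := by
            rw [lintegral_const_mul]; fun_prop
        _ ≤ _ := by
            gcongr with t
            intro hx
            simp [hx]
    rw [this, ENNReal.mul_top]
    simpa using hq

lemma measurable_ballMeas {n : ℕ} (σ : Measure (EuclideanSpace ℝ (Fin n)))
    (x : EuclideanSpace ℝ (Fin n)) : Measurable fun r : ℝ => σ (ball x r) :=
  Monotone.measurable fun _ _ h => measure_mono (ball_subset_ball h)

lemma measurable_wolffIntegrand {n : ℕ} (p : ℝ) (σ : Measure (EuclideanSpace ℝ (Fin n)))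
    (x : EuclideanSpace ℝ (Fin n)) : Measurable fun r : ℝ =>
    (σ (ball x r) / ENNReal.ofReal (r ^ ((n : ℝ) - p))) ^ (1 / (p - 1)) / ENNReal.ofReal r := by
  have := measurable_ballMeas σ x
  exact ((this.div (by fun_prop)).pow_const _).div (by fun_prop)

lemma ball_le_liminf {n : ℕ} (σ : Measure (EuclideanSpace ℝ (Fin n)))
    (x : EuclideanSpace ℝ (Fin n)) (u : ℕ → EuclideanSpace ℝ (Fin n))
    (hu : Tendsto u atTop (𝓝 x)) (r : ℝ) :
    σ (ball x r) ≤ liminf (fun k => σ (ball (u k) r)) atTop := by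
  have h := lintegral_liminf_le (μ := σ) (u := atTop)
    (f := fun k => (ball (u k) r).indicator (fun _ => (1:ℝ≥0∞)))
    (fun k => measurable_const.indicator measurableSet_ball)
  simp only [lintegral_indicator_one measurableSet_ball, ← Pi.one_def] at h
  refine le_trans ?_ h
  rw [← lintegral_indicator_one measurableSet_ball]
  apply lintegral_mono
  intro y
  by_cases hy : y ∈ ball x r
  · refine le_trans ?_ (le_liminf_of_le (a := 1) ?_ ?_)
    · simp [hy]
    · isBoundedDefault
    · have : Tendsto (fun k => dist y (u k)) atTop (𝓝 (dist y x)) := tendsto_const_nhds.dist hu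
      filter_upwards [this.eventually (gt_mem_nhds (mem_ball.1 hy))] with k hk
      simp [mem_ball.2 hk]
  · simp [hy]

lemma isClosed_wolff_le {n : ℕ} (p : ℝ) (hp : 1 < p) (σ : Measure (EuclideanSpace ℝ (Fin n)))
    (a : ℝ≥0∞) : IsClosed {x | wolff n p σ x ≤ a} := by
  apply IsSeqClosed.isClosed
  intro u x hu hx
  change wolff n p σ x ≤ a
  have hs : 0 ≤ 1 / (p - 1) := by
    have : 0 < p - 1 := by linarith
    positivity
  calc wolff n p σ x ≤ ∫⁻ r in Set.Ioi (0 : ℝ), liminf (fun k =>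
      (σ (ball (u k) r) / ENNReal.ofReal (r ^ ((n : ℝ) - p))) ^ (1 / (p - 1)) / ENNReal.ofReal r)
        atTop := by
        apply setLIntegral_mono' measurableSet_Ioi
        intro r hr
        have hr : 0 < r := hr
        have hrp : 0 < r ^ ((n:ℝ) - p) := Real.rpow_pos_of_pos hr _
        have hm : Monotone (fun y : ℝ≥0∞ => (y / ENNReal.ofReal (r ^ ((n : ℝ) - p))) ^ (1 / (p - 1))
            / ENNReal.ofReal r) := by
          intro y z hyz
          dsimp only
          gcongr
        have hc : Continuous (fun y : ℝ≥0∞ => (y / ENNReal.ofReal (r ^ ((n : ℝ) - p))) ^ (1 / (p - 1))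
            / ENNReal.ofReal r) := by
          have h1 := ENNReal.continuous_div_const (ENNReal.ofReal r) (by simpa using hr)
          have h2 := ENNReal.continuous_div_const (ENNReal.ofReal (r ^ ((n : ℝ) - p)))
            (by simpa using hrp)
          exact h1.comp (ENNReal.continuous_rpow_const.comp h2)
        have h3 := hm.map_liminf_of_continuousAt (F := atTop) (fun k => σ (ball (u k) r))
          hc.continuousAt
        exact le_trans (hm (ball_le_liminf σ x u hx r)) h3.le
    _ ≤ liminf (fun k => wolff n p σ (u k)) atTop :=
        lintegral_liminf_le fun k => measurable_wolffIntegrand p σ (u k)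
    _ ≤ liminf (fun k => a) (atTop : Filter ℕ) := by
        exact liminf_le_liminf (Eventually.of_forall hu)
    _ = a := by simp

lemma measurable_wolff {n : ℕ} (p : ℝ) (hp : 1 < p) (σ : Measure (EuclideanSpace ℝ (Fin n))) :
    Measurable (wolff n p σ) :=
  measurable_of_Iic fun a => (isClosed_wolff_le p hp σ a).measurableSet

lemma wolff_add_le {n : ℕ} (p : ℝ) (hp : 1 < p) (σ τ : Measure (EuclideanSpace ℝ (Fin n)))
    (x : EuclideanSpace ℝ (Fin n)) :
    wolff n p (σ + τ) x ≤ 2 ^ (1 / (p - 1)) * (wolff n p σ x + wolff n p τ x) := by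
  have hs : 0 < 1 / (p - 1) := by
    have : 0 < p - 1 := by linarith
    positivity
  unfold wolff
  rw [← lintegral_add_left (measurable_wolffIntegrand p σ x), ← lintegral_const_mul]
  swap
  · exact (measurable_wolffIntegrand p σ x).add (measurable_wolffIntegrand p τ x)
  apply lintegral_mono
  intro r
  dsimp only
  rw [← ENNReal.add_div, ← mul_div_assoc]
  gcongr
  rw [Measure.add_apply, ENNReal.add_div]
  generalize σ (ball x r) / ENNReal.ofReal (r ^ ((n : ℝ) - p)) = a
  generalize τ (ball x r) / ENNReal.ofReal (r ^ ((n : ℝ) - p)) = b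
  generalize 1 / (p - 1) = s at *
  calc (a + b) ^ s ≤ (2 * max a b) ^ s := by
        gcongr
        rw [two_mul]
        gcongr
        · exact le_max_left _ _
        · exact le_max_right _ _
    _ = 2 ^ s * (max a b) ^ s := ENNReal.mul_rpow_of_nonneg _ _ hs.le
    _ ≤ _ := by
        gcongr
        rcases le_total a b with h | h
        · simp [h]
        · simp [h]

lemma wolff_zero {n : ℕ} (p : ℝ) (hp : 1 < p)
    (x : EuclideanSpace ℝ (Fin n)) : wolff n p 0 x = 0 := by
  have hs : 0 < 1 / (p - 1) := by
    have : 0 < p - 1 := by linarith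
    positivity
  unfold wolff
  simp only [Measure.coe_zero, Pi.zero_apply, ENNReal.zero_div, ENNReal.zero_rpow_of_pos hs,
    lintegral_zero]

lemma wolff_max_principle {n : ℕ} (p : ℝ) (hp : 1 < p)
    (μ : Measure (EuclideanSpace ℝ (Fin n)))
    (a : ℝ≥0∞) (x : EuclideanSpace ℝ (Fin n)) :
    wolff n p (μ.restrict {x | wolff n p μ x ≤ a}) x ≤
      ENNReal.ofReal ((2:ℝ) ^ (((n:ℝ) - p) * (1 / (p - 1)))) * a := by
  have hs : 0 < 1 / (p - 1) := by
    have : 0 < p - 1 := by linarith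
    positivity
  set F := {x | wolff n p μ x ≤ a} with hF
  have hFc : IsClosed F := isClosed_wolff_le p hp μ a
  rcases F.eq_empty_or_nonempty with h | h
  · rw [h, Measure.restrict_empty]
    have : wolff n p 0 x = 0 := wolff_zero p hp x
    simp [this]
  obtain ⟨z, hzF, hz⟩ := hFc.exists_infDist_eq_dist h x
  have key : ∀ r, μ.restrict F (ball x r) ≤ μ (ball z (2 * r)) := by
    intro r
    rw [Measure.restrict_apply measurableSet_ball]
    apply measure_mono
    rintro y ⟨hy, hyF⟩
    have h1 : dist x z ≤ dist x y := by rw [← hz]; exact infDist_le_dist_of_mem hyF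
    rw [mem_ball] at hy ⊢
    have := dist_triangle y x z
    rw [dist_comm x y] at h1
    linarith
  have himg : Set.image (fun r : ℝ => 2 * r) (Set.Ioi 0) = Set.Ioi 0 := by
    ext y
    simp only [Set.mem_image, Set.mem_Ioi]
    constructor
    · rintro ⟨r, hr, rfl⟩; linarith
    · intro hy; exact ⟨y / 2, by linarith, by ring⟩
  have hcv := lintegral_image_eq_lintegral_abs_deriv_mul (s := Set.Ioi (0:ℝ))
    (f := fun r : ℝ => 2 * r) (f' := fun _ => 2) measurableSet_Ioi
    (fun r _ => by simpa using ((hasDerivAt_id r).const_mul 2).hasDerivWithinAt)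
    (fun r _ r' _ h => by simpa using h)
    (fun r => (μ (ball z r) / ENNReal.ofReal (r ^ ((n : ℝ) - p))) ^ (1 / (p - 1)) / ENNReal.ofReal r)
  rw [himg] at hcv
  have hW : wolff n p μ z ≤ a := hzF
  refine le_trans ?_ (mul_le_mul_right hW _)
  unfold wolff
  rw [hcv, ← lintegral_const_mul']
  swap; · exact ENNReal.ofReal_ne_top
  apply setLIntegral_mono' measurableSet_Ioi
  intro r hr
  have hr : 0 < r := hr
  generalize 1 / (p - 1) = s at *
  have e1 : ENNReal.ofReal ((2 * r) ^ ((n:ℝ) - p)) =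
      ENNReal.ofReal (2 ^ ((n:ℝ) - p)) * ENNReal.ofReal (r ^ ((n:ℝ) - p)) := by
    rw [Real.mul_rpow (by norm_num) hr.le, ENNReal.ofReal_mul (by positivity)]
  have e2 : ENNReal.ofReal (2 * r) = 2 * ENNReal.ofReal r := by
    rw [ENNReal.ofReal_mul (by norm_num)]; simp
  have e3 : ENNReal.ofReal (|2|) = 2 := by simp
  have e4 : ENNReal.ofReal ((2:ℝ) ^ (((n:ℝ) - p) * s)) = ENNReal.ofReal (2 ^ ((n:ℝ) - p)) ^ s := by
    rw [Real.rpow_mul (by norm_num), ENNReal.ofReal_rpow_of_nonneg (by positivity) hs.le]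
  rw [e1, e2, e3, e4]
  set A := ENNReal.ofReal ((2:ℝ) ^ ((n:ℝ) - p)) with hA
  have hA0 : A ≠ 0 := by
    rw [hA]; simp only [ne_eq, ENNReal.ofReal_eq_zero, not_le]; positivity
  have hAt : A ≠ ⊤ := ENNReal.ofReal_ne_top
  set R := ENNReal.ofReal (r ^ ((n:ℝ) - p))
  calc _ ≤ (μ (ball z (2 * r)) / R) ^ s / ENNReal.ofReal r := by
        have := key r
        gcongr (?_ / _) ^ s / _
    _ = _ := by
      have : μ (ball z (2 * r)) / R = A * (μ (ball z (2 * r)) / (A * R)) := by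
        rw [← mul_div_assoc, ENNReal.mul_div_mul_left _ _ hA0 hAt]
      rw [this, ENNReal.mul_rpow_of_nonneg _ _ hs.le, mul_div_assoc]
      congr 1
      rw [← mul_div_assoc, ENNReal.mul_div_mul_left _ _ (by norm_num) (by norm_num)]

lemma lint_head {q δ : ℝ} (hq : 0 < q) (hδ : 0 < δ) :
    ∫⁻ r in Set.Ioc 0 δ, ENNReal.ofReal (r ^ (q - 1)) = ENNReal.ofReal (δ ^ q / q) := by
  have hi : IntervalIntegrable (fun r : ℝ => r ^ (q - 1)) volume 0 δ :=
    intervalIntegral.intervalIntegrable_rpow' (by linarith)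
  have h := integral_rpow (a := 0) (b := δ) (r := q - 1) (Or.inl (by linarith))
  rw [intervalIntegral.integral_of_le hδ.le] at h
  rw [← ofReal_integral_eq_lintegral_ofReal, h]
  · simp [Real.zero_rpow hq.ne']
  · exact (intervalIntegrable_iff_integrableOn_Ioc_of_le hδ.le).1 hi
  · filter_upwards [ae_restrict_mem measurableSet_Ioc] with t ht
    exact Real.rpow_nonneg (le_of_lt ht.1) _

lemma lint_tail {q δ : ℝ} (hq : 0 < q) (hδ : 0 < δ) :
    ∫⁻ r in Set.Ioi δ, ENNReal.ofReal (r ^ (-q - 1)) = ENNReal.ofReal (δ ^ (-q) / q) := by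
  rw [← ofReal_integral_eq_lintegral_ofReal, integral_Ioi_rpow_of_lt (by linarith) hδ]
  · congr 1
    rw [show -q - 1 + 1 = -q by ring, neg_div_neg_eq]
  · exact integrableOn_Ioi_rpow_of_lt (by linarith) hδ
  · filter_upwards [ae_restrict_mem measurableSet_Ioi] with t ht
    exact Real.rpow_nonneg (hδ.trans ht).le _

lemma integrand_le {β s r b : ℝ} (hs : 0 ≤ s) (hr : 0 < r) (hb : 0 ≤ b) {m : ℝ≥0∞}
    (hm : m ≤ ENNReal.ofReal b) :
    (m / ENNReal.ofReal (r ^ β)) ^ s / ENNReal.ofReal r ≤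
      ENNReal.ofReal (b ^ s * r ^ (-(β * s) - 1)) := by
  have hrp : 0 < r ^ β := Real.rpow_pos_of_pos hr _
  calc _ ≤ (ENNReal.ofReal b / ENNReal.ofReal (r ^ β)) ^ s / ENNReal.ofReal r := by gcongr
    _ = ENNReal.ofReal ((b / r ^ β) ^ s / r) := by
        rw [← ENNReal.ofReal_div_of_pos hrp, ENNReal.ofReal_rpow_of_nonneg (by positivity) hs,
          ← ENNReal.ofReal_div_of_pos hr]
    _ ≤ _ := by
        apply ENNReal.ofReal_le_ofReal
        apply le_of_eq
        rw [Real.div_rpow hb hrp.le, ← Real.rpow_mul hr.le, Real.rpow_sub hr, Real.rpow_neg hr.le,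
          Real.rpow_one]
        field_simp

lemma wolff_le_of_small {n : ℕ} (p : ℝ) (hp : 1 < p) (hpn : p < n)
    (ν : Measure (EuclideanSpace ℝ (Fin n))) (x : EuclideanSpace ℝ (Fin n))
    {M κ δ : ℝ} (hM : 0 < M) (hκ : 0 < κ) (hδ : 0 < δ)
    (hν : ν Set.univ ≤ ENNReal.ofReal M)
    (hb : ∀ r, 0 < r → r ≤ δ → ν (ball x r) ≤ ENNReal.ofReal (κ * r ^ (n:ℝ))) :
    wolff n p ν x ≤ ENNReal.ofReal (κ ^ (1 / (p - 1)) * (δ ^ (p * (1 / (p - 1))) / (p * (1 / (p - 1))))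
      + M ^ (1 / (p - 1)) *
        (δ ^ (-(((n:ℝ) - p) * (1 / (p - 1)))) / (((n:ℝ) - p) * (1 / (p - 1))))) := by
  have hs : 0 < 1 / (p - 1) := by
    have : 0 < p - 1 := by linarith
    positivity
  have hβ : 0 < (n:ℝ) - p := by linarith
  unfold wolff
  generalize 1 / (p - 1) = s at *
  generalize hβd : (n:ℝ) - p = β at *
  have hps : 0 < p * s := by positivity
  have hβs : 0 < β * s := by positivity
  rw [← Set.Ioc_union_Ioi_eq_Ioi hδ.le, lintegral_union measurableSet_Ioi
    (Set.Ioc_disjoint_Ioi le_rfl), ENNReal.ofReal_add (by positivity) (by positivity),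
    ENNReal.ofReal_mul (by positivity), ENNReal.ofReal_mul (by positivity),
    ← lint_head hps hδ, ← lint_tail hβs hδ, ← lintegral_const_mul' _ _ ENNReal.ofReal_ne_top,
    ← lintegral_const_mul' _ _ ENNReal.ofReal_ne_top]
  apply add_le_add
  · apply setLIntegral_mono' measurableSet_Ioc
    rintro r ⟨hr, hrδ⟩
    refine (integrand_le hs.le hr (by positivity) (hb r hr hrδ)).trans ?_
    rw [← ENNReal.ofReal_mul (by positivity)]
    apply ENNReal.ofReal_le_ofReal
    apply le_of_eq
    rw [Real.mul_rpow hκ.le (by positivity), ← Real.rpow_mul hr.le, mul_assoc, ← Real.rpow_add hr]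
    congr 2
    rw [← hβd]; ring
  · apply setLIntegral_mono' measurableSet_Ioi
    intro r hr
    have hr : 0 < r := hδ.trans hr
    refine (integrand_le hs.le hr hM.le ((measure_mono (Set.subset_univ _)).trans hν)).trans ?_
    rw [← ENNReal.ofReal_mul (by positivity)]

lemma vitali_bound {n : ℕ} (ν : Measure (EuclideanSpace ℝ (Fin n)))
    (E : Set (EuclideanSpace ℝ (Fin n))) {κ R : ℝ} (hκ : 0 < κ)
    (hE : ∀ x ∈ E, ∃ r, 0 < r ∧ r ≤ R ∧ ENNReal.ofReal (κ * r ^ (n:ℝ)) ≤ ν (ball x r)) :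
    ENNReal.ofReal κ * volume E ≤
      ENNReal.ofReal (5 ^ n) * volume (ball (0:EuclideanSpace ℝ (Fin n)) 1) * ν Set.univ := by
  choose! ρ h0 hR hρ using hE
  obtain ⟨u, huE, hdisj, hcov⟩ := Vitali.exists_disjoint_subfamily_covering_enlargement_closedBall
    E (fun x => x) ρ R hR 5 (by norm_num)
  have hcount : u.Countable := hdisj.countable_of_nonempty_interior fun x hx =>
    (nonempty_ball.2 (h0 x (huE hx))).mono ball_subset_interior_closedBall
  have hsub : E ⊆ ⋃ x ∈ u, closedBall x (5 * ρ x) := by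
    intro x hx
    obtain ⟨b, hb, hsb⟩ := hcov x hx
    exact Set.mem_biUnion hb (hsb (mem_closedBall_self (h0 x hx).le))
  have : Countable u := hcount.to_subtype
  set V := volume (ball (0:EuclideanSpace ℝ (Fin n)) 1)
  calc ENNReal.ofReal κ * volume E
      ≤ ENNReal.ofReal κ * ∑' x : u, volume (closedBall (x:EuclideanSpace ℝ (Fin n)) (5 * ρ x)) := by
        gcongr
        exact (measure_mono hsub).trans (measure_biUnion_le _ hcount _)
    _ = ∑' x : u, ENNReal.ofReal κ * volume (closedBall (x:EuclideanSpace ℝ (Fin n)) (5 * ρ x)) :=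
        ENNReal.tsum_mul_left.symm
    _ ≤ ∑' x : u, ENNReal.ofReal (5 ^ n) * V * ν (closedBall (x:EuclideanSpace ℝ (Fin n)) (ρ x)) := by
        apply ENNReal.tsum_le_tsum
        rintro ⟨x, hx⟩
        have hp := h0 x (huE hx)
        have h1 := (hρ x (huE hx)).trans (measure_mono ball_subset_closedBall)
        rw [Measure.addHaar_closedBall _ _ (by positivity)]
        simp only [finrank_euclideanSpace, Fintype.card_fin]
        refine le_trans (le_of_eq ?_) (mul_le_mul_right h1 _)
        rw [mul_pow, ENNReal.ofReal_mul (by positivity), ENNReal.ofReal_mul hκ.le, Real.rpow_natCast]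
        ring
    _ = ENNReal.ofReal (5 ^ n) * V * ν (⋃ x ∈ u, closedBall x (ρ x)) := by
        rw [ENNReal.tsum_mul_left, measure_biUnion hcount hdisj fun _ _ => measurableSet_closedBall]
    _ ≤ _ := by gcongr; exact Set.subset_univ _

lemma wolff_weak (n : ℕ) (p : ℝ) (hp : 1 < p) (hpn : p < n) :
    ∃ A : ℝ, 0 < A ∧ ∀ (ν : Measure (EuclideanSpace ℝ (Fin n))) (l : ℝ), 0 < l →
      volume {x | ENNReal.ofReal l < wolff n p ν x} ^ (((n:ℝ) - p) / n) ≤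
        ENNReal.ofReal A * (ν Set.univ * ENNReal.ofReal (l ^ (-(p - 1)))) := by
  have hs : 0 < 1 / (p - 1) := by
    have : 0 < p - 1 := by linarith
    positivity
  have hβ : 0 < (n:ℝ) - p := by linarith
  have hp0 : 0 < p := by linarith
  have hp1 : 0 < p - 1 := by linarith
  have hn0 : 0 < (n:ℝ) := by linarith
  set V := volume (ball (0:EuclideanSpace ℝ (Fin n)) 1) with hV
  have hVt : V ≠ ⊤ := measure_ball_lt_top.ne
  have hV0 : 0 < V := measure_ball_pos _ _ one_pos
  have hVr : 0 < V.toReal := ENNReal.toReal_pos hV0.ne' hVt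
  obtain ⟨s, hsd⟩ : ∃ s, s = 1 / (p - 1) := ⟨_, rfl⟩
  obtain ⟨β, hβd⟩ : ∃ β, β = (n:ℝ) - p := ⟨_, rfl⟩
  rw [← hsd] at hs
  rw [← hβd] at hβ ⊢
  have hps1 : (p - 1) * s = 1 := by rw [hsd]; field_simp
  set c1 := (2 / (β * s)) ^ (p - 1) with hc1
  set c2 := (p * s / 2) ^ (p - 1) with hc2
  have hc1p : 0 < c1 := by positivity
  have hc2p : 0 < c2 := by positivity
  refine ⟨(5 ^ n * V.toReal * (c1 ^ (p / β) / c2)) ^ (β / n), by positivity, ?_⟩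
  intro ν l hl
  have hlp : 0 < l ^ (-(p - 1)) := Real.rpow_pos_of_pos hl _
  rcases eq_or_ne (ν Set.univ) ⊤ with htop | htop
  · rw [htop, ENNReal.top_mul (by simpa using hlp), ENNReal.mul_top]
    · exact le_top
    · simp only [ne_eq, ENNReal.ofReal_eq_zero, not_le]; positivity
  rcases eq_or_ne (ν Set.univ) 0 with hz | hz
  · have : ν = 0 := Measure.measure_univ_eq_zero.1 hz
    subst this
    simp only [wolff_zero p hp]
    simp [div_pos hβ hn0]
  obtain ⟨M, hMd⟩ : ∃ M, M = (ν Set.univ).toReal := ⟨_, rfl⟩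
  have hM : 0 < M := hMd ▸ ENNReal.toReal_pos hz htop
  have hMν : ν Set.univ = ENNReal.ofReal M := by rw [hMd, ENNReal.ofReal_toReal htop]
  obtain ⟨X, hXd⟩ : ∃ X, X = M * l ^ (-(p - 1)) := ⟨_, rfl⟩
  have hX : 0 < X := by rw [hXd]; positivity
  obtain ⟨δ, hδd⟩ : ∃ δ, δ = (c1 * X) ^ (1 / β) := ⟨_, rfl⟩
  have hδ : 0 < δ := by rw [hδd]; positivity
  obtain ⟨κ, hκd⟩ : ∃ κ, κ = c2 * l ^ (p - 1) * δ ^ (-p) := ⟨_, rfl⟩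
  have hκ : 0 < κ := by rw [hκd]; positivity
  -- the two halves
  have half1 : κ ^ s * (δ ^ (p * s) / (p * s)) = l / 2 := by
    have : κ ^ s = (p * s / 2) * l * δ ^ (-(p * s)) := by
      rw [hκd, Real.mul_rpow (by positivity) (by positivity), Real.mul_rpow (by positivity)
        (by positivity), hc2, ← Real.rpow_mul (by positivity), ← Real.rpow_mul hl.le,
        ← Real.rpow_mul hδ.le, hps1, Real.rpow_one, Real.rpow_one, neg_mul]
    rw [this, Real.rpow_neg hδ.le]
    have := Real.rpow_pos_of_pos hδ (p * s)
    field_simp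
  have half2 : M ^ s * (δ ^ (-(β * s)) / (β * s)) = l / 2 := by
    have e1 : δ ^ (β * s) = (2 / (β * s)) * (M ^ s * l⁻¹) := by
      rw [hδd, ← Real.rpow_mul (by positivity), show 1 / β * (β * s) = s by field_simp,
        Real.mul_rpow hc1p.le hX.le, hc1, ← Real.rpow_mul (by positivity), hps1, Real.rpow_one,
        hXd, Real.mul_rpow hM.le hlp.le, ← Real.rpow_mul hl.le, neg_mul, hps1, Real.rpow_neg_one]
    rw [Real.rpow_neg hδ.le, e1]
    have := Real.rpow_pos_of_pos hM s
    field_simp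
  have hE : ∀ x ∈ {x | ENNReal.ofReal l < wolff n p ν x},
      ∃ r, 0 < r ∧ r ≤ δ ∧ ENNReal.ofReal (κ * r ^ (n:ℝ)) ≤ ν (ball x r) := by
    intro x hx
    by_contra hcon
    push Not at hcon
    have := wolff_le_of_small p hp hpn ν x hM hκ hδ hMν.le (fun r h1 h2 => (hcon r h1 h2).le)
    rw [← hsd, ← hβd, half1, half2, add_halves] at this
    exact absurd this (not_le.2 hx)
  have hv := vitali_bound ν _ hκ hE
  set E := {x | ENNReal.ofReal l < wolff n p ν x}
  have hv2 : volume E ≤ ENNReal.ofReal (5 ^ n * V.toReal * (c1 ^ (p / β) / c2) * X ^ ((n:ℝ) / β)) := by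
    have e : 5 ^ n * V.toReal * (c1 ^ (p / β) / c2) * X ^ ((n:ℝ) / β) = 5 ^ n * V.toReal * M / κ := by
      have e1 : δ ^ p = c1 ^ (p / β) * X ^ (p / β) := by
        rw [hδd, ← Real.rpow_mul (by positivity), Real.mul_rpow hc1p.le hX.le]
        congr 2 <;> ring
      have e2 : X ^ ((n:ℝ) / β) = X * X ^ (p / β) := by
        rw [show (n:ℝ) / β = 1 + p / β by rw [hβd] at hβ ⊢; field_simp; ring, Real.rpow_add hX,
          Real.rpow_one]
      have e3 : M = X * l ^ (p - 1) := by
        rw [hXd, Real.rpow_neg hl.le]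
        have := Real.rpow_pos_of_pos hl (p - 1)
        field_simp
      rw [e2, hκd, Real.rpow_neg hδ.le, e1, e3]
      have := Real.rpow_pos_of_pos hl (p - 1)
      have := Real.rpow_pos_of_pos hX (p / β)
      have := Real.rpow_pos_of_pos hc1p (p / β)
      field_simp
    rw [e, ENNReal.ofReal_div_of_pos hκ, ENNReal.le_div_iff_mul_le (by left; simpa using hκ)
      (by left; simp), mul_comm, ENNReal.ofReal_mul (by positivity),
      ENNReal.ofReal_mul (by positivity), ENNReal.ofReal_toReal hVt, ← hMν]
    exact hv
  calc volume E ^ (β / n) ≤ (ENNReal.ofReal (5 ^ n * V.toReal * (c1 ^ (p / β) / c2) *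
        X ^ ((n:ℝ) / β))) ^ (β / n) := by gcongr
    _ = _ := by
      rw [ENNReal.ofReal_rpow_of_nonneg (by positivity) (by positivity), Real.mul_rpow
        (by positivity) (by positivity), ← Real.rpow_mul hX.le,
        show (n:ℝ) / β * (β / n) = 1 by field_simp, Real.rpow_one,
        ENNReal.ofReal_mul (by positivity), hXd, ENNReal.ofReal_mul hM.le, hMν]

/-- Good-lambda type weak estimate. -/
lemma wolff_level (n : ℕ) (p : ℝ) (hp : 1 < p) (hpn : p < n) :
    ∃ A c : ℝ, 0 < A ∧ 0 < c ∧ ∀ (μ : Measure (EuclideanSpace ℝ (Fin n))) (l : ℝ), 0 < l →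
      volume {x | ENNReal.ofReal l < wolff n p μ x} ^ (((n:ℝ) - p) / n) ≤
        ENNReal.ofReal A * (μ {x | ENNReal.ofReal (c * l) < wolff n p μ x} *
          ENNReal.ofReal (l ^ (-(p - 1)))) := by
  obtain ⟨A, hA, hw⟩ := wolff_weak n p hp hpn
  have hs : 0 < 1 / (p - 1) := by
    have : 0 < p - 1 := by linarith
    positivity
  have hβ : 0 < (n:ℝ) - p := by linarith
  have hn0 : 0 < (n:ℝ) := by linarith
  set K := (2:ℝ) ^ (1 / (p - 1)) with hK
  set L := (2:ℝ) ^ (((n:ℝ) - p) * (1 / (p - 1))) with hL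
  have hK0 : 0 < K := by positivity
  have hL0 : 0 < L := by positivity
  set d := 1 / (2 * K) with hd
  have hd0 : 0 < d := by positivity
  refine ⟨A * d ^ (-(p - 1)), 1 / (2 * K * L), by positivity, by positivity, ?_⟩
  intro μ l hl
  set c := 1 / (2 * K * L) with hc
  have hc0 : 0 < c := by positivity
  set F := {x | wolff n p μ x ≤ ENNReal.ofReal (c * l)} with hF
  have hFm : MeasurableSet F := (isClosed_wolff_le p hp μ _).measurableSet
  have hFc : {x | ENNReal.ofReal (c * l) < wolff n p μ x} = Fᶜ := by
    ext x; simp [hF]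
  have hsub : {x | ENNReal.ofReal l < wolff n p μ x} ⊆
      {x | ENNReal.ofReal (d * l) < wolff n p (μ.restrict Fᶜ) x} := by
    intro x hx
    simp only [Set.mem_ofPred_eq] at hx ⊢
    by_contra hcon
    rw [not_lt] at hcon
    apply absurd hx
    rw [not_lt]
    have h1 := wolff_add_le p hp (μ.restrict Fᶜ) (μ.restrict F) x
    rw [Measure.restrict_compl_add_restrict hFm] at h1
    have h2 := wolff_max_principle p hp μ (ENNReal.ofReal (c * l)) x
    have hK2 : (2:ℝ≥0∞) ^ (1 / (p - 1)) = ENNReal.ofReal K := by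
      rw [hK, ← ENNReal.ofReal_rpow_of_nonneg (by norm_num) hs.le]; simp
    calc wolff n p μ x ≤ _ := h1
      _ ≤ ENNReal.ofReal K * (ENNReal.ofReal (d * l) + ENNReal.ofReal L * ENNReal.ofReal (c * l)) := by
        rw [hK2]
        gcongr
      _ = ENNReal.ofReal (K * (d * l + L * (c * l))) := by
        rw [← ENNReal.ofReal_mul hL0.le, ← ENNReal.ofReal_add (by positivity) (by positivity),
          ← ENNReal.ofReal_mul hK0.le]
      _ = ENNReal.ofReal l := by
        congr 1
        rw [hd, hc]
        field_simp
        norm_num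
  calc _ ≤ volume {x | ENNReal.ofReal (d * l) < wolff n p (μ.restrict Fᶜ) x} ^ (((n:ℝ) - p) / n) := by
        gcongr
    _ ≤ _ := hw _ _ (by positivity)
    _ = _ := by
        rw [hFc, Measure.restrict_apply_univ, Real.mul_rpow hd0.le hl.le,
          ENNReal.ofReal_mul (by positivity), ENNReal.ofReal_mul hA.le]
        ring

lemma antitone_rearrangement {n : ℕ} (f : EuclideanSpace ℝ (Fin n) → ℝ≥0∞) :
    Antitone (rearrangement f) := by
  intro s t hst
  apply sInf_le_sInf
  intro a ha
  exact le_trans ha (ENNReal.ofReal_le_ofReal hst)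

lemma lint_head_ennreal {a : ℝ} (ha : 0 < a) (D : ℝ≥0∞) :
    ∫⁻ t in Set.Ioi (0:ℝ) ∩ {t | ENNReal.ofReal t < D}, ENNReal.ofReal (t ^ (a - 1)) ≤
      ENNReal.ofReal (1 / a) * D ^ a := by
  rcases eq_or_ne D ⊤ with h | h
  · rw [h, ENNReal.top_rpow_of_pos ha, ENNReal.mul_top]
    · exact le_top
    · simpa using ha
  rcases eq_or_ne D 0 with h0 | h0
  · simp [h0]
  have hD : 0 < D.toReal := ENNReal.toReal_pos h0 h
  calc _ ≤ ∫⁻ t in Set.Ioc 0 D.toReal, ENNReal.ofReal (t ^ (a - 1)) := by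
        apply lintegral_mono_set
        rintro t ⟨ht, ht2⟩
        exact ⟨ht, ((ENNReal.ofReal_lt_iff_lt_toReal (le_of_lt ht) h).1 ht2).le⟩
    _ = _ := by
        rw [lint_head ha hD, div_eq_mul_one_div, mul_comm, ENNReal.ofReal_mul (by positivity),
          ← ENNReal.ofReal_rpow_of_nonneg ENNReal.toReal_nonneg ha.le, ENNReal.ofReal_toReal h]

lemma lorentz_le {n : ℕ} (f : EuclideanSpace ℝ (Fin n) → ℝ≥0∞) {a q : ℝ} (ha : 0 < a)
    (hq : 0 < q) :
    ∫⁻ t in Set.Ioi (0:ℝ), ENNReal.ofReal (t ^ (a - 1)) * rearrangement f t ^ q ≤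
      ENNReal.ofReal q * ∫⁻ l in Set.Ioi (0:ℝ), (ENNReal.ofReal (1 / a) *
        volume {x | ENNReal.ofReal l < f x} ^ a) * ENNReal.ofReal (l ^ (q - 1)) := by
  have hm : Measurable (rearrangement f) := (antitone_rearrangement f).measurable
  have hw : Measurable fun t : ℝ => ENNReal.ofReal (t ^ (a - 1)) := by fun_prop
  have h1 := lintegral_withDensity_eq_lintegral_mul (volume.restrict (Set.Ioi (0:ℝ))) hw
    (hm.pow_const q)
  simp only [Pi.mul_apply] at h1
  rw [← h1, layercake_ennreal _ hm hq]
  gcongr with l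
  have hset : MeasurableSet {t | ENNReal.ofReal l < rearrangement f t} :=
    measurableSet_lt measurable_const hm
  rw [withDensity_apply _ hset, Measure.restrict_restrict hset]
  refine le_trans ?_ (lint_head_ennreal ha _)
  apply lintegral_mono_set
  rintro t ⟨ht, ht0⟩
  refine ⟨ht0, ?_⟩
  simp only [Set.mem_ofPred_eq] at ht ⊢
  by_contra hcon
  rw [not_lt] at hcon
  exact absurd ht (not_lt.2 (sInf_le hcon))

lemma lint_scale (g : ℝ → ℝ≥0∞) {c : ℝ} (hc : 0 < c) :
    ∫⁻ l in Set.Ioi (0:ℝ), g l = ENNReal.ofReal c * ∫⁻ l in Set.Ioi (0:ℝ), g (c * l) := by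
  have himg : Set.image (fun r : ℝ => c * r) (Set.Ioi 0) = Set.Ioi 0 := by
    ext y
    simp only [Set.mem_image, Set.mem_Ioi]
    constructor
    · rintro ⟨r, hr, rfl⟩; positivity
    · intro hy; exact ⟨y / c, by positivity, by field_simp⟩
  have hcv := lintegral_image_eq_lintegral_abs_deriv_mul (s := Set.Ioi (0:ℝ))
    (f := fun r : ℝ => c * r) (f' := fun _ => c) measurableSet_Ioi
    (fun r _ => by simpa using ((hasDerivAt_id r).const_mul c).hasDerivWithinAt)
    (fun r _ r' _ h => by simpa [hc.ne'] using h) g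
  rw [himg, abs_of_pos hc, lintegral_const_mul' _ _ ENNReal.ofReal_ne_top] at hcv
  exact hcv

lemma wolff_main (n : ℕ) (p γ : ℝ) (hp : 1 < p) (hpn : p < n) (hγ : 0 < γ) :
    ∃ C : ℝ≥0∞, 0 < C ∧ C < ⊤ ∧
      ∀ μ : Measure (EuclideanSpace ℝ (Fin n)),
        ∫⁻ t in Set.Ioi (0:ℝ), ENNReal.ofReal (t ^ (((n:ℝ) - p) / n - 1)) *
          rearrangement (wolff n p μ) t ^ (p - 1 + γ) ≤ C * ∫⁻ x, (wolff n p μ x) ^ γ ∂μ := by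
  obtain ⟨A, c, hA, hc, hlev⟩ := wolff_level n p hp hpn
  have hβ : 0 < (n:ℝ) - p := by linarith
  have hn0 : 0 < (n:ℝ) := by linarith
  have ha : 0 < ((n:ℝ) - p) / n := by positivity
  have hq : 0 < p - 1 + γ := by linarith
  generalize ((n:ℝ) - p) / n = a at *
  set q := p - 1 + γ with hqd
  set C1 := q * (1 / a) * A with hC1
  have hC1p : 0 < C1 := by positivity
  refine ⟨ENNReal.ofReal (C1 * c⁻¹ * (c ^ (γ - 1))⁻¹ * γ⁻¹), ?_, ENNReal.ofReal_lt_top, ?_⟩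
  · rw [ENNReal.ofReal_pos]; positivity
  intro μ
  refine (lorentz_le _ ha hq).trans ?_
  have hlc := layercake_ennreal μ (measurable_wolff p hp μ) hγ
  rw [lint_scale _ hc] at hlc
  have hcp : 0 < c ^ (γ - 1) := by positivity
  set I := ∫⁻ l in Set.Ioi (0:ℝ), μ {x | ENNReal.ofReal (c * l) < wolff n p μ x} *
    ENNReal.ofReal (l ^ (γ - 1)) with hI
  have e1 : ∫⁻ l in Set.Ioi (0:ℝ), μ {x | ENNReal.ofReal (c * l) < wolff n p μ x} *
    ENNReal.ofReal ((c * l) ^ (γ - 1)) = ENNReal.ofReal (c ^ (γ - 1)) * I := by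
    rw [hI, ← lintegral_const_mul' _ _ ENNReal.ofReal_ne_top]
    apply setLIntegral_congr_fun measurableSet_Ioi
    intro l hl
    have hl : 0 < l := hl
    dsimp only
    rw [Real.mul_rpow hc.le hl.le, ENNReal.ofReal_mul hcp.le]
    ring
  rw [e1] at hlc
  have e2 : ENNReal.ofReal (C1 * c⁻¹ * (c ^ (γ - 1))⁻¹ * γ⁻¹) * ∫⁻ x, (wolff n p μ x) ^ γ ∂μ
      = ENNReal.ofReal C1 * I := by
    rw [hlc, ← mul_assoc, ← mul_assoc, ← mul_assoc, ← ENNReal.ofReal_mul (by positivity),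
      ← ENNReal.ofReal_mul (by positivity), ← ENNReal.ofReal_mul (by positivity)]
    congr 2
    field_simp
  rw [e2, hC1, ENNReal.ofReal_mul (by positivity), ENNReal.ofReal_mul hq.le, mul_assoc, mul_assoc]
  gcongr
  rw [hI, ← lintegral_const_mul' _ _ ENNReal.ofReal_ne_top,
    ← lintegral_const_mul' _ _ ENNReal.ofReal_ne_top]
  apply setLIntegral_mono' measurableSet_Ioi
  intro l hl
  have hl : 0 < l := hl
  rw [mul_assoc]
  refine mul_le_mul_right ?_ _
  calc _ ≤ ENNReal.ofReal A * (μ {x | ENNReal.ofReal (c * l) < wolff n p μ x} *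
          ENNReal.ofReal (l ^ (-(p - 1)))) * ENNReal.ofReal (l ^ (q - 1)) := by
        gcongr
        exact hlev μ l hl
    _ = _ := by
        rw [mul_assoc, mul_assoc, ← ENNReal.ofReal_mul (by positivity), ← Real.rpow_add hl]
        congr 4
        rw [hqd]; ring

/-- Corollary 3.6: Lorentz space estimate for Wolff potentials,
`‖W_{1,p}μ‖_{L^{r,ρ}} ≤ C (∫ (W_{1,p}μ)^γ dμ)^{1/(p-1+γ)}` with
`r = n(p-1+γ)/(n-p)`, `ρ = p-1+γ`. -/
theorem wolff_lorentz_estimate (n : ℕ) (p γ : ℝ) (hp : 1 < p) (hpn : p < n) (hγ : 0 < γ) :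
    ∃ C : ℝ≥0∞, 0 < C ∧ C < ⊤ ∧
      ∀ μ : Measure (EuclideanSpace ℝ (Fin n)),
        lorentzNorm ((n : ℝ) * (p - 1 + γ) / ((n : ℝ) - p)) (p - 1 + γ) (wolff n p μ) ≤
          C * (∫⁻ x, (wolff n p μ x) ^ γ ∂μ) ^ (1 / (p - 1 + γ)) := by
  obtain ⟨C, hC0, hCt, hC⟩ := wolff_main n p γ hp hpn hγ
  have hβ : 0 < (n:ℝ) - p := by linarith
  have hn0 : 0 < (n:ℝ) := by linarith
  have hq : 0 < p - 1 + γ := by linarith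
  have hq' : 0 < 1 / (p - 1 + γ) := by positivity
  refine ⟨C ^ (1 / (p - 1 + γ)), ENNReal.rpow_pos hC0 hCt.ne,
    ENNReal.rpow_lt_top_of_nonneg hq'.le hCt.ne, ?_⟩
  intro μ
  rw [← ENNReal.mul_rpow_of_nonneg _ _ hq'.le]
  unfold lorentzNorm
  gcongr
  refine le_trans (le_of_eq ?_) (hC μ)
  apply setLIntegral_congr_fun measurableSet_Ioi
  intro t ht
  have ht : 0 < t := ht
  dsimp only
  have e : 1 / ((n:ℝ) * (p - 1 + γ) / ((n:ℝ) - p)) * (p - 1 + γ) = ((n:ℝ) - p) / n := by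
    field_simp
  rw [ENNReal.mul_rpow_of_nonneg _ _ hq.le, ENNReal.ofReal_rpow_of_nonneg (by positivity) hq.le,
    ← Real.rpow_mul ht.le, e, Real.rpow_sub_one ht.ne', ENNReal.ofReal_div_of_pos ht,
    ENNReal.div_eq_inv_mul, ENNReal.div_eq_inv_mul]
  ring
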